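/- Let A ∈ ℝ^{ν×ν} and C ∈ ℝ^{1×ν}, and let P₀ ∈ ℝ^{ν×ν} be a symmetric positive definite solution of the Riccati equation A P₀ + P₀ Aᵀ + I_ν − P₀ Cᵀ C P₀ = 0. Let H ∈ ℝ^{n×n} be a matrix all of whose eigenvalues have strictly positive real part, let μ > 1 / min_i Re(λ_i(H)) (the minimum over the real parts of the eigenvalues of H), and set K = μ P₀ Cᵀ ∈ ℝ^{ν×1}. Then the matrix I_n ⊗ A − (H ⊗ (K C)) ∈ ℝ^{nν×nν} is Hurwitz. -/

import Mathlib

open Matrix Kronecker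

open scoped MatrixOrder ComplexOrder in
theorem Matrix.PosDef.map_ofReal {m : Type*} [Fintype m] [DecidableEq m] {P : Matrix m m ℝ}
    (hP : P.PosDef) : (P.map Complex.ofReal).PosDef := by
  obtain ⟨B, hB⟩ := CStarAlgebra.nonneg_iff_eq_star_mul_self.mp
    (Matrix.nonneg_iff_posSemidef.mpr hP.posSemidef)
  have hmap : P.map Complex.ofReal = (B.map Complex.ofReal)ᴴ * B.map Complex.ofReal := by
    rw [hB]
    ext i j
    simp [Matrix.mul_apply, Matrix.star_eq_conjTranspose]
  have hpsd : (P.map Complex.ofReal).PosSemidef := by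
    rw [hmap]
    exact Matrix.posSemidef_conjTranspose_mul_self _
  exact hpsd.posDef_iff_isUnit.mpr (hP.isUnit.map Complex.ofRealHom.mapMatrix)

open scoped ComplexOrder in
/-- Lyapunov's criterion: if `P` and `-(F P + P Fᴴ)` are positive definite, then every eigenvalue
of `F` has negative real part. -/
theorem Matrix.PosDef.re_neg_of_lyapunov {m : Type*} [Fintype m] [DecidableEq m]
    {F P : Matrix m m ℂ} (hP : P.PosDef) (hF : (-(F * P + P * Fᴴ)).PosDef)
    {z : ℂ} {y : m → ℂ} (hy : y ≠ 0) (hz : F *ᵥ y = z • y) : z.re < 0 := by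
  set x := P⁻¹ *ᵥ y with hx
  have hPx : P *ᵥ x = y := by
    rw [hx, Matrix.mulVec_mulVec,
      Matrix.mul_nonsing_inv _ ((Matrix.isUnit_iff_isUnit_det _).mp hP.isUnit),
      Matrix.one_mulVec]
  have hx0 : x ≠ 0 := by
    intro h
    rw [h, Matrix.mulVec_zero] at hPx
    exact hy hPx.symm
  have hFPx : (F * P) *ᵥ x = z • (P *ᵥ x) := by
    rw [← Matrix.mulVec_mulVec, hPx, hz]
  have hleft : star x ⬝ᵥ (F * P) *ᵥ x = z * (star x ⬝ᵥ P *ᵥ x) := by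
    rw [hFPx, dotProduct_smul, smul_eq_mul]
  have hright : star x ⬝ᵥ (P * Fᴴ) *ᵥ x = star z * star (star x ⬝ᵥ P *ᵥ x) := by
    have hadj : P * Fᴴ = (F * P)ᴴ := by
      rw [Matrix.conjTranspose_mul, hP.isHermitian.eq]
    rw [hadj, Matrix.dotProduct_mulVec, ← Matrix.star_mulVec, hFPx, star_smul,
      smul_dotProduct, smul_eq_mul, ← Matrix.star_dotProduct]
  have hpos := hP.dotProduct_mulVec_pos hx0
  have hneg := hF.dotProduct_mulVec_pos hx0
  rw [Matrix.neg_mulVec, dotProduct_neg, Matrix.add_mulVec, dotProduct_add, hleft, hright] at hneg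
  obtain ⟨hre, him⟩ := Complex.lt_def.mp hpos
  have hneg' := (Complex.lt_def.mp hneg).1
  simp only [Complex.zero_re, Complex.zero_im] at hre him
  simp [← him] at hneg'
  nlinarith

/-- Commuting endomorphisms have a common eigenvector for any eigenvalue of the first. -/
theorem Module.End.HasEigenvalue.exists_common_eigenvector {k V : Type*} [Field k] [IsAlgClosed k]
    [AddCommGroup V] [Module k V] [FiniteDimensional k V] {f g : Module.End k V}
    (hfg : Commute f g) {z : k} (hz : f.HasEigenvalue z) :
    ∃ (l : k) (v : V), v ≠ 0 ∧ f v = z • v ∧ g v = l • v := by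
  have hmaps : ∀ v ∈ f.eigenspace z, g v ∈ f.eigenspace z :=
    Module.End.mapsTo_genEigenspace_of_comm hfg z 1
  have : Nontrivial (f.eigenspace z) := Submodule.nontrivial_iff_ne_bot.mpr hz
  obtain ⟨l, hl⟩ := Module.End.exists_eigenvalue (g.restrict hmaps)
  obtain ⟨v, hv⟩ := hl.exists_hasEigenvector
  refine ⟨l, v, ?_, Module.End.mem_eigenspace_iff.mp v.2, ?_⟩
  · simpa using hv.2
  · simpa using congrArg Subtype.val hv.apply_eq_smul

theorem Matrix.mem_spectrum_iff_exists_mulVec {k m : Type*} [Field k] [Fintype m] [DecidableEq m]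
    {M : Matrix m m k} {z : k} : z ∈ spectrum k M ↔ ∃ v, v ≠ 0 ∧ M *ᵥ v = z • v := by
  rw [← Matrix.spectrum_toLin', ← Module.End.hasEigenvalue_iff_mem_spectrum]
  constructor
  · intro h
    obtain ⟨v, hv⟩ := h.exists_hasEigenvector
    exact ⟨v, hv.2, by simpa using hv.apply_eq_smul⟩
  · rintro ⟨v, hv0, hv⟩
    exact Module.End.hasEigenvalue_of_hasEigenvector
      ⟨Module.End.mem_eigenspace_iff.mpr (by simpa using hv), hv0⟩

/-- Every eigenvalue of `1 ⊗ A - H ⊗ B` is an eigenvalue of `A - l • B` for some eigenvalue `l`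
of `H`. -/
theorem Matrix.exists_mem_spectrum_of_mem_spectrum_kronecker {k m n : Type*} [Field k]
    [IsAlgClosed k] [Fintype m] [DecidableEq m] [Fintype n] [DecidableEq n]
    {A B : Matrix m m k} {H : Matrix n n k} {z : k}
    (hz : z ∈ spectrum k ((1 : Matrix n n k) ⊗ₖ A - H ⊗ₖ B)) :
    ∃ l ∈ spectrum k H, z ∈ spectrum k (A - l • B) := by
  rw [← Matrix.spectrum_toLin', ← Module.End.hasEigenvalue_iff_mem_spectrum] at hz
  have hcomm : Commute (Matrix.toLin' ((1 : Matrix n n k) ⊗ₖ A - H ⊗ₖ B))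
      (Matrix.toLin' (H ⊗ₖ (1 : Matrix m m k))) := by
    change _ * _ = _ * _
    rw [Module.End.mul_eq_comp, Module.End.mul_eq_comp, ← Matrix.toLin'_mul, ← Matrix.toLin'_mul,
      sub_mul, mul_sub]
    simp only [← Matrix.mul_kronecker_mul, one_mul, mul_one]
  obtain ⟨l, v, hv0, hv, hvl⟩ := hz.exists_common_eigenvector hcomm
  rw [Matrix.toLin'_apply] at hv hvl
  obtain ⟨⟨i, j⟩, hij⟩ := Function.ne_iff.mp hv0
  have hH (i : n) (j : m) : ∑ i', H i i' * v (i', j) = l * v (i, j) := by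
    simpa [Matrix.mulVec, dotProduct, Fintype.sum_prod_type, Matrix.one_apply]
      using congrFun hvl (i, j)
  refine ⟨l, Matrix.mem_spectrum_iff_exists_mulVec.mpr ⟨fun i' => v (i', j), ?_, ?_⟩,
    Matrix.mem_spectrum_iff_exists_mulVec.mpr ⟨fun j' => v (i, j'), ?_, ?_⟩⟩
  · exact fun h => hij (congrFun h i)
  · ext i'
    exact hH i' j
  · exact fun h => hij (congrFun h j)
  · ext j'
    have hA : (((1 : Matrix n n k) ⊗ₖ A) *ᵥ v) (i, j') = ∑ a, A j' a * v (i, a) := by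
      simp only [Matrix.mulVec, dotProduct, Fintype.sum_prod_type_right, Matrix.kroneckerMap_apply]
      simp [Matrix.one_apply]
    have hB : ((H ⊗ₖ B) *ᵥ v) (i, j') = ∑ a, l * B j' a * v (i, a) := by
      simp only [Matrix.mulVec, dotProduct, Fintype.sum_prod_type_right, Matrix.kroneckerMap_apply]
      refine Finset.sum_congr rfl fun a _ => ?_
      rw [mul_comm l, mul_assoc, ← hH i a, Finset.mul_sum]
      exact Finset.sum_congr rfl fun b _ => by ring
    have h := congrFun hv (i, j')
    rw [Matrix.sub_mulVec, Pi.sub_apply, hA, hB] at h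
    rw [Matrix.sub_mulVec, Pi.sub_apply]
    exact h

/-- With `P₀` a symmetric positive definite solution of the Riccati equation
`A P₀ + P₀ Aᵀ + I − P₀ Cᵀ C P₀ = 0`, `H` a matrix all of whose eigenvalues have positive real
part, `μ > 1 / min Re λ(H)` (equivalently `1 / Re z < μ` for every eigenvalue `z` of `H`), and
`K = μ P₀ Cᵀ`, the matrix `Iₙ ⊗ A − H ⊗ (K C)` is Hurwitz. -/
theorem stmt_6 (ν n : ℕ) (hn : 1 ≤ n)
    (A : Matrix (Fin ν) (Fin ν) ℝ) (C : Matrix (Fin 1) (Fin ν) ℝ)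
    (P₀ : Matrix (Fin ν) (Fin ν) ℝ) (hP₀ : P₀.PosDef)
    (hRic : A * P₀ + P₀ * Aᵀ + 1 - P₀ * Cᵀ * C * P₀ = 0)
    (H : Matrix (Fin n) (Fin n) ℝ)
    (hH : ∀ z ∈ spectrum ℂ (H.map Complex.ofReal), 0 < z.re)
    (μ : ℝ) (hμ : ∀ z ∈ spectrum ℂ (H.map Complex.ofReal), 1 / z.re < μ)
    (K : Matrix (Fin ν) (Fin 1) ℝ) (hK : K = μ • (P₀ * Cᵀ)) :
    ∀ z ∈ spectrum ℂ
        (((1 : Matrix (Fin n) (Fin n) ℝ) ⊗ₖ A - H ⊗ₖ (K * C)).map Complex.ofReal),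
      z.re < 0 := by
  intro z hz
  have hmap : ((1 : Matrix (Fin n) (Fin n) ℝ) ⊗ₖ A - H ⊗ₖ (K * C)).map Complex.ofReal =
      (1 : Matrix (Fin n) (Fin n) ℂ) ⊗ₖ A.map Complex.ofReal -
        H.map Complex.ofReal ⊗ₖ (K * C).map Complex.ofReal := by
    ext ⟨i, a⟩ ⟨j, b⟩
    by_cases h : i = j <;> simp [h]
  rw [hmap] at hz
  obtain ⟨l, hl, hzl⟩ := Matrix.exists_mem_spectrum_of_mem_spectrum_kronecker hz
  obtain ⟨y, hy0, hy⟩ := Matrix.mem_spectrum_iff_exists_mulVec.mp hzl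
  have hlre := hH l hl
  have hgain : 1 < μ * l.re := (div_lt_iff₀ hlre).mp (hμ l hl)
  refine hP₀.map_ofReal.re_neg_of_lyapunov ?_ hy0 hy
  set D : Matrix (Fin 1) (Fin ν) ℂ := (C * P₀).map Complex.ofReal with hD
  have hPt : P₀ᵀ = P₀ := by simpa using hP₀.isHermitian.eq
  have hPC : (P₀.map Complex.ofReal)ᴴ = P₀.map Complex.ofReal := by
    open scoped ComplexOrder in exact hP₀.map_ofReal.isHermitian.eq
  have hRicc : A.map Complex.ofReal * P₀.map Complex.ofReal +
      P₀.map Complex.ofReal * (A.map Complex.ofReal)ᴴ = Dᴴ * D - 1 := by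
    have hreal : A * P₀ + P₀ * Aᵀ = (C * P₀)ᵀ * (C * P₀) - 1 := by
      rw [Matrix.transpose_mul, hPt, ← Matrix.mul_assoc, eq_sub_iff_add_eq]
      exact sub_eq_zero.mp hRic
    have hcast := congrArg Complex.ofRealHom.mapMatrix hreal
    have hDt : Dᴴ = (C * P₀)ᵀ.map Complex.ofReal := by
      ext i j
      exact Complex.conj_ofReal _
    have hAt : (A.map Complex.ofReal)ᴴ = Aᵀ.map Complex.ofReal := by
      ext i j
      simp
    rw [hDt, hAt, hD]
    simp only [map_add, map_sub, map_mul, map_one] at hcast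
    refine hcast.trans (congrArg (· - 1) ?_)
    exact Matrix.map_mul (f := Complex.ofRealHom)
  have hKP : (K * C).map Complex.ofReal * P₀.map Complex.ofReal = (μ : ℂ) • (Dᴴ * D) := by
    have hreal : K * C * P₀ = μ • ((C * P₀)ᵀ * (C * P₀)) := by
      rw [hK, Matrix.transpose_mul, hPt, Matrix.smul_mul, Matrix.smul_mul, Matrix.mul_assoc]
    ext i j
    have hij := congrArg Complex.ofReal (congrFun (congrFun hreal i) j)
    simpa [Matrix.mul_apply, hD, -Matrix.transpose_mul] using hij
  have hPK : P₀.map Complex.ofReal * ((K * C).map Complex.ofReal)ᴴ = (μ : ℂ) • (Dᴴ * D) := by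
    have h := congrArg Matrix.conjTranspose hKP
    rw [Matrix.conjTranspose_mul, hPC] at h
    simpa using h
  have hsum : -((A.map Complex.ofReal - l • (K * C).map Complex.ofReal) * P₀.map Complex.ofReal +
      P₀.map Complex.ofReal * (A.map Complex.ofReal - l • (K * C).map Complex.ofReal)ᴴ) =
      1 + ((2 * (μ * l.re) - 1 : ℝ) : ℂ) • (Dᴴ * D) := by
    rw [Matrix.conjTranspose_sub, Matrix.conjTranspose_smul, sub_mul, mul_sub, Matrix.smul_mul,
      Matrix.mul_smul, hKP, hPK, sub_add_sub_comm, hRicc, smul_smul, smul_smul, ← add_smul]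
    have hcoef : l * (μ : ℂ) + star l * (μ : ℂ) = ((2 * (μ * l.re) : ℝ) : ℂ) := by
      apply Complex.ext <;> simp
      ring
    rw [hcoef]
    push_cast
    module
  rw [hsum]
  open scoped ComplexOrder in
  refine Matrix.PosDef.one.add_posSemidef
    ((Matrix.posSemidef_conjTranspose_mul_self D).smul ?_)
  exact Complex.zero_le_real.mpr (by linarith)
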